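/- arXiv:2407.00595 — 2 statements merged into one kernel-verified Lean document; each statement's English description precedes it below -/
import Mathlib

section
/- (Stability of the fully invertible hyperbolic network, Theorem 1, quantitative form.) Let K : EuclideanSpace ℝ (Fin n) →L[ℝ] EuclideanSpace ℝ (Fin m) with adjoint Kᵀ, and let σ : ℝ → ℝ be 1-Lipschitz. Define F(u,v) = (-Kᵀ v, σ∘(K u)) on the product E = EuclideanSpace ℝ (Fin n) × EuclideanSpace ℝ (Fin m) with norm ‖(a,b)‖² = ‖a‖² + ‖b‖². If x₁, x₂ : ℝ → E satisfy HasDerivAt xᵢ (F (xᵢ t)) t for all t ∈ [0, T], then ‖x₁ T - x₂ T‖ ≤ exp(‖K‖ · T) · ‖x₁ 0 - x₂ 0‖, i.e., the network is stable with a constant c = exp(‖K‖ T)² > 0 depending only on K and the final time T, not on the solutions. -/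
set_option maxHeartbeats 1000000
set_option synthInstance.maxHeartbeats 1000000

/-- Stability of the fully invertible hyperbolic network (quantitative form):
for the first-order system `∂ₜ(u,v) = F(u,v) = (-Kᵀ v, σ∘(K u))` with 1-Lipschitz `σ`,
any two solutions on `[0, T]` satisfy `‖x₁ T - x₂ T‖ ≤ exp(‖K‖ T) ‖x₁ 0 - x₂ 0‖`. -/
theorem stmt_5 (n m : ℕ) (K : EuclideanSpace ℝ (Fin n) →L[ℝ] EuclideanSpace ℝ (Fin m))
    (σ : ℝ → ℝ) (hσ : LipschitzWith 1 σ)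
    (F : WithLp 2 (EuclideanSpace ℝ (Fin n) × EuclideanSpace ℝ (Fin m)) →
      WithLp 2 (EuclideanSpace ℝ (Fin n) × EuclideanSpace ℝ (Fin m)))
    (hF : ∀ x, F x =
      (WithLp.equiv 2 (EuclideanSpace ℝ (Fin n) × EuclideanSpace ℝ (Fin m))).symm
        (-(ContinuousLinearMap.adjoint K) (WithLp.equiv 2 _ x).2,
          (WithLp.toLp 2 (fun i => σ ((K ((WithLp.equiv 2 _ x).1)) i)) : EuclideanSpace ℝ (Fin m))))
    (T : ℝ) (hT : 0 ≤ T)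
    (x₁ x₂ : ℝ → WithLp 2 (EuclideanSpace ℝ (Fin n) × EuclideanSpace ℝ (Fin m)))
    (hx₁ : ∀ t ∈ Set.Icc (0 : ℝ) T, HasDerivAt x₁ (F (x₁ t)) t)
    (hx₂ : ∀ t ∈ Set.Icc (0 : ℝ) T, HasDerivAt x₂ (F (x₂ t)) t) :
    ‖x₁ T - x₂ T‖ ≤ Real.exp (‖K‖ * T) * ‖x₁ 0 - x₂ 0‖ := by
  have hlip : LipschitzWith ‖K‖₊ F := by
    refine LipschitzWith.of_dist_le_mul fun x y => ?_
    rw [dist_eq_norm, dist_eq_norm]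
    refine (sq_le_sq₀ (by positivity) (by positivity)).mp ?_
    rw [mul_pow, WithLp.prod_norm_sq_eq_of_L2, WithLp.prod_norm_sq_eq_of_L2]
    have h1 : ‖(F x - F y).fst‖ ≤ ‖K‖ * ‖(x - y).snd‖ := by
      have e : (F x - F y).fst = -(ContinuousLinearMap.adjoint K) (x - y).snd := by
        rw [hF, hF]
        simp [map_sub]
        abel
      rw [e, norm_neg]
      refine (ContinuousLinearMap.le_opNorm _ _).trans_eq ?_
      rw [LinearIsometryEquiv.norm_map]
    have h2 : ‖(F x - F y).snd‖ ≤ ‖K‖ * ‖(x - y).fst‖ := by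
      refine le_trans ?_ (K.le_opNorm (x - y).fst)
      rw [EuclideanSpace.norm_eq, EuclideanSpace.norm_eq]
      refine Real.sqrt_le_sqrt (Finset.sum_le_sum fun i _ => ?_)
      have h := hσ.dist_le_mul (K x.fst i) (K y.fst i)
      rw [hF, hF]
      simp only [Real.dist_eq, NNReal.coe_one, one_mul] at h
      simpa [map_sub] using sq_le_sq.mpr (by simpa using h)
    have h1' := pow_le_pow_left₀ (norm_nonneg _) h1 2
    have h2' := pow_le_pow_left₀ (norm_nonneg _) h2 2
    rw [mul_pow] at h1' h2'
    rw [coe_nnnorm]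
    linarith
  have h := dist_le_of_trajectories_ODE (v := fun _ => F) (fun _ => hlip)
    (fun t ht => (hx₁ t ht).continuousAt.continuousWithinAt)
    (fun t ht => (hx₁ t (Set.Ico_subset_Icc_self ht)).hasDerivWithinAt)
    (fun t ht => (hx₂ t ht).continuousAt.continuousWithinAt)
    (fun t ht => (hx₂ t (Set.Ico_subset_Icc_self ht)).hasDerivWithinAt)
    le_rfl T ⟨hT, le_rfl⟩
  rw [dist_eq_norm, dist_eq_norm, sub_zero, coe_nnnorm, mul_comm] at h
  exact h
end

section
/- (Full invertibility of the hyperbolic network.) Let E be a real inner product space, n ≥ 3, and for each layer j let W_j : E ≃ₗᵢ[ℝ] E be a linear isometry equivalence, K_j : E →L[ℝ] E a continuous linear map with adjoint K_jᵀ, σ : E → E any map, h ∈ ℝ. Define the forward map G : E × E → E × E sending an initial pair (Y₁, Y₂) to the final pair (Y_{n-1}, Y_n) via the recursion Y_j = 2 • W_{j-1} Y_{j-1} - W_{j-2} Y_{j-2} - h² • K_jᵀ (σ (K_j (W_{j-1} Y_{j-1}))) for j = 3, …, n. Then G is a bijection of E × E; in particular, the map X ↦ G(X, X) is injective, so the network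 input is uniquely determined by (and recomputable from) the two final states. -/
/-- The state sequence of the multi-resolution hyperbolic network:
`hypSeq W K σ h Y₁ Y₂ j` is the state `Y_j` of the recursion
`Y_j = 2 W_{j-1} Y_{j-1} - W_{j-2} Y_{j-2} - h² K_jᵀ σ(K_j (W_{j-1} Y_{j-1}))`
with `Y 1 = Y₁` and `Y 2 = Y₂` (the value at `0` is irrelevant). -/
noncomputable def hypSeq {E : Type*} [NormedAddCommGroup E] [InnerProductSpace ℝ E] [CompleteSpace E]
    (W : ℕ → (E ≃ₗᵢ[ℝ] E)) (K : ℕ → (E →L[ℝ] E)) (σ : E → E) (h : ℝ)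
    (Y₁ Y₂ : E) : ℕ → E
  | 0 => Y₁
  | 1 => Y₁
  | 2 => Y₂
  | (j + 3) =>
      (2 : ℝ) • (W (j + 2)) (hypSeq W K σ h Y₁ Y₂ (j + 2)) -
        (W (j + 1)) (hypSeq W K σ h Y₁ Y₂ (j + 1)) -
        h ^ 2 • (ContinuousLinearMap.adjoint (K (j + 3)))
          (σ ((K (j + 3)) ((W (j + 2)) (hypSeq W K σ h Y₁ Y₂ (j + 2)))))

lemma hypSeq_step_bij {E : Type*} [NormedAddCommGroup E] [InnerProductSpace ℝ E]
    (U V : E ≃ₗᵢ[ℝ] E) (F : E → E) :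
    Function.Bijective (fun q : E × E => (q.2, (2 : ℝ) • V q.2 - U q.1 - F q.2)) := by
  constructor
  · rintro ⟨a, b⟩ ⟨c, d⟩ hq
    simp only [Prod.mk.injEq] at hq
    obtain ⟨rfl, h2⟩ := hq
    have h3 : U a = U c := by simpa using h2
    rw [U.injective h3]
  · rintro ⟨a, b⟩
    refine ⟨(U.symm ((2 : ℝ) • V a - F a - b), a), ?_⟩
    simp only [LinearIsometryEquiv.apply_symm_apply, Prod.mk.injEq, true_and]
    abel

lemma hypSeq_bij {E : Type*} [NormedAddCommGroup E] [InnerProductSpace ℝ E] [CompleteSpace E]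
    (W : ℕ → (E ≃ₗᵢ[ℝ] E)) (K : ℕ → (E →L[ℝ] E)) (σ : E → E) (h : ℝ) (m : ℕ) :
    Function.Bijective (fun p : E × E =>
      (hypSeq W K σ h p.1 p.2 (m + 1), hypSeq W K σ h p.1 p.2 (m + 2))) := by
  induction m with
  | zero =>
    simp only [hypSeq]
    exact Function.bijective_id
  | succ m ih =>
    have := (hypSeq_step_bij (W (m + 1)) (W (m + 2)) (fun y =>
      h ^ 2 • (ContinuousLinearMap.adjoint (K (m + 3)))
          (σ ((K (m + 3)) ((W (m + 2)) y))))).comp ih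
    convert this using 1
    funext p
    simp only [Function.comp, Prod.mk.injEq]
    exact ⟨trivial, by rw [show m + 1 + 2 = m + 3 from rfl, hypSeq]⟩

/-- Full invertibility of the hyperbolic network: the forward map sending the
initial pair `(Y₁, Y₂)` to the final pair `(Y_{n-1}, Y_n)` is a bijection of
`E × E`; in particular `X ↦ G (X, X)` is injective, so the network input is
uniquely determined by the two final states. -/
theorem stmt_10 {E : Type*} [NormedAddCommGroup E] [InnerProductSpace ℝ E] [CompleteSpace E]
    (n : ℕ) (hn : 3 ≤ n)
    (W : ℕ → (E ≃ₗᵢ[ℝ] E)) (K : ℕ → (E →L[ℝ] E)) (σ : E → E) (h : ℝ)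
    (G : E × E → E × E)
    (hG : ∀ p : E × E, G p =
      (hypSeq W K σ h p.1 p.2 (n - 1), hypSeq W K σ h p.1 p.2 n)) :
    Function.Bijective G ∧ Function.Injective (fun X : E => G (X, X)) := by
  obtain ⟨m, rfl⟩ : ∃ m, n = m + 2 := ⟨n - 2, by omega⟩
  have hb : Function.Bijective G := by
    have h0 := hypSeq_bij W K σ h m
    convert h0 using 1
    funext p
    exact hG p
  refine ⟨hb, fun X Y hXY => ?_⟩
  exact congrArg Prod.fst (hb.1 hXY)
end
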